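/- Let u be a 1-periodic incompressible Lipschitz vector field on D = ℝ² or ℝ × 𝕋, and suppose every streamline of u intersecting some nonempty open bounded set Y ⊂ D is bounded, and u does not vanish identically on any open subset of Y. Then u has a non-trivial closed (periodic) streamline, i.e. there exists y and τ > 0 with X(y, τ) = y and u(y) ≠ 0. -/

import Mathlib

open MeasureTheory
open scoped NNReal

open Filter Topology

lemma aux_bdd (u : ℝ × ℝ → ℝ × ℝ) (hc : Continuous u)
    (huper1 : ∀ x : ℝ × ℝ, u (x + (1, 0)) = u x)
    (huper2 : ∀ x : ℝ × ℝ, u (x + (0, 1)) = u x) : ∃ M : ℝ, 0 ≤ M ∧ ∀ x, ‖u x‖ ≤ M := by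
  have hcpt : IsCompact (Set.Icc (0:ℝ) 1 ×ˢ Set.Icc (0:ℝ) 1) := isCompact_Icc.prod isCompact_Icc
  obtain ⟨M, hM⟩ := hcpt.exists_bound_of_continuousOn hc.continuousOn
  have h1 : ∀ x y : ℝ, u (Int.fract x, y) = u (x, y) := by
    intro x y
    have hp : Function.Periodic (fun s : ℝ => u (s, y)) 1 := by
      intro s
      have := huper1 (s, y)
      simpa using this
    have := hp.sub_int_mul_eq (x := x) ⌊x⌋
    rw [mul_one] at this
    exact this
  have h2 : ∀ x y : ℝ, u (x, Int.fract y) = u (x, y) := by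
    intro x y
    have hp : Function.Periodic (fun s : ℝ => u (x, s)) 1 := by
      intro s
      have := huper2 (x, s)
      simpa using this
    have := hp.sub_int_mul_eq (x := y) ⌊y⌋
    rw [mul_one] at this
    exact this
  have hb : ∀ x, ‖u x‖ ≤ M := by
    rintro ⟨x, y⟩
    rw [← h1, ← h2]
    exact hM _ ⟨⟨Int.fract_nonneg _, (Int.fract_lt_one _).le⟩,
      ⟨Int.fract_nonneg _, (Int.fract_lt_one _).le⟩⟩
  exact ⟨M, (norm_nonneg _).trans (hb 0), hb⟩

lemma aux_flow (u : ℝ × ℝ → ℝ × ℝ) (Ku : ℝ≥0) (hu : LipschitzWith Ku u)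
    (X : ℝ × ℝ → ℝ → ℝ × ℝ)
    (hX0 : ∀ x, X x 0 = x)
    (hXode : ∀ x t, HasDerivAt (X x) (u (X x t)) t) (x : ℝ × ℝ) (s t : ℝ) :
    X x (s + t) = X (X x s) t := by
  have := ODE_solution_unique_univ (v := fun _ => u) (s := fun _ => Set.univ) (K := Ku)
    (f := fun t => X x (s + t)) (g := X (X x s)) (t₀ := 0)
    (fun _ => hu.lipschitzOnWith)
    (fun t => ⟨by
      have := (hXode x (s + t)).scomp t ((hasDerivAt_id t).const_add s)
      rw [one_smul] at this
      exact this, trivial⟩)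
    (fun t => ⟨hXode _ _, trivial⟩) (by simp [hX0])
  exact congrFun this t

lemma aux_speed (u : ℝ × ℝ → ℝ × ℝ) (M : ℝ) (hM : ∀ x, ‖u x‖ ≤ M)
    (X : ℝ × ℝ → ℝ → ℝ × ℝ)
    (hX0 : ∀ x, X x 0 = x)
    (hXode : ∀ x t, HasDerivAt (X x) (u (X x t)) t) (x : ℝ × ℝ) (t : ℝ) :
    ‖X x t - x‖ ≤ M * |t| := by
  have := Convex.norm_image_sub_le_of_norm_hasDerivWithin_le (f := X x)
    (f' := fun s => u (X x s)) (s := Set.univ) (x := 0) (y := t) (C := M)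
    (fun s _ => (hXode x s).hasDerivWithinAt) (fun s _ => hM _) convex_univ trivial trivial
  simpa [hX0] using this

lemma aux_err (u : ℝ × ℝ → ℝ × ℝ) (Ku : ℝ≥0) (hu : LipschitzWith Ku u)
    (M : ℝ) (hM : ∀ x, ‖u x‖ ≤ M)
    (X : ℝ × ℝ → ℝ → ℝ × ℝ)
    (hX0 : ∀ x, X x 0 = x)
    (hXode : ∀ x t, HasDerivAt (X x) (u (X x t)) t) (x : ℝ × ℝ) (h : ℝ) :
    ‖X x h - (x + h • u x)‖ ≤ Ku * M * h ^ 2 := by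
  have hM0 : 0 ≤ M := (norm_nonneg _).trans (hM 0)
  have := Convex.norm_image_sub_le_of_norm_hasDerivWithin_le (f := fun s => X x s - s • u x)
    (f' := fun s => u (X x s) - u x) (s := Set.uIcc 0 h) (x := 0) (y := h) (C := Ku * (M * |h|))
    (fun s _ => by
      have := (hXode x s).sub ((hasDerivAt_id s).smul_const (u x))
      rw [one_smul] at this
      exact this.hasDerivWithinAt) (fun s hs => by
      have h1 : ‖u (X x s) - u x‖ ≤ Ku * ‖X x s - x‖ := by
        simpa [dist_eq_norm] using hu.dist_le_mul (X x s) x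
      refine h1.trans ?_
      gcongr
      refine (aux_speed u M hM X hX0 hXode x s).trans ?_
      have := Set.abs_sub_left_of_mem_uIcc hs
      simp only [sub_zero] at this
      exact mul_le_mul_of_nonneg_left this hM0) (convex_uIcc _ _) (by simp) (by simp)
  simp only [hX0, zero_smul, sub_zero, Real.norm_eq_abs] at this
  calc _ = ‖X x h - h • u x - x‖ := by congr 1; abel
    _ ≤ _ := this
    _ = _ := by rw [← sq_abs h]; ring

lemma aux_iter (u : ℝ × ℝ → ℝ × ℝ) (Ku : ℝ≥0) (hu : LipschitzWith Ku u)
    (M : ℝ) (hM : ∀ x, ‖u x‖ ≤ M)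
    (X : ℝ × ℝ → ℝ → ℝ × ℝ)
    (hX0 : ∀ x, X x 0 = x)
    (hXode : ∀ x t, HasDerivAt (X x) (u (X x t)) t) (x : ℝ × ℝ) (h : ℝ) (k : ℕ) :
    ‖(fun z => z + h • u z)^[k] x - X x (k * h)‖ ≤ k * (Ku * M * h ^ 2) * (1 + Ku * |h|) ^ k := by
  have hM0 : 0 ≤ M := (norm_nonneg _).trans (hM 0)
  induction k with
  | zero => simp [hX0]
  | succ k ih =>
    rw [Function.iterate_succ_apply']
    set y := (fun z => z + h • u z)^[k] x
    have e1 : X x ((k + 1 : ℕ) * h) = X (X x (k * h)) h := by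
      rw [← aux_flow u Ku hu X hX0 hXode]; congr 1; push_cast; ring
    rw [e1]
    set y' := X x (k * h)
    have h1 := aux_err u Ku hu M hM X hX0 hXode y' h
    have h2 : ‖u y - u y'‖ ≤ Ku * ‖y - y'‖ := by
      simpa [dist_eq_norm] using hu.dist_le_mul y y'
    have h3 : y + h • u y - X y' h = (y - y') + h • (u y - u y') - (X y' h - (y' + h • u y')) := by
      rw [smul_sub]; abel
    have h4 : ‖y + h • u y - X y' h‖ ≤ ‖y - y'‖ + |h| * (Ku * ‖y - y'‖) + Ku * M * h ^ 2 := by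
      rw [h3]
      refine (norm_sub_le _ _).trans (add_le_add ((norm_add_le _ _).trans ?_) h1)
      rw [norm_smul, Real.norm_eq_abs]
      gcongr
    refine h4.trans ?_
    have hq : 1 ≤ 1 + Ku * |h| := by
      have : 0 ≤ Ku * |h| := by positivity
      linarith
    have hp : 1 ≤ (1 + Ku * |h|) ^ (k+1) := one_le_pow₀ hq
    have hE : 0 ≤ Ku * M * h ^ 2 := by positivity
    calc ‖y - y'‖ + |h| * (Ku * ‖y - y'‖) + Ku * M * h ^ 2
        = (1 + Ku * |h|) * ‖y - y'‖ + Ku * M * h ^ 2 * 1 := by ring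
      _ ≤ (1 + Ku * |h|) * (k * (Ku * M * h ^ 2) * (1 + Ku * |h|) ^ k)
          + Ku * M * h ^ 2 * (1 + Ku * |h|) ^ (k+1) := by gcongr
      _ = _ := by push_cast; ring

lemma aux_conv (u : ℝ × ℝ → ℝ × ℝ) (Ku : ℝ≥0) (hu : LipschitzWith Ku u)
    (M : ℝ) (hM : ∀ x, ‖u x‖ ≤ M)
    (X : ℝ × ℝ → ℝ → ℝ × ℝ)
    (hX0 : ∀ x, X x 0 = x)
    (hXode : ∀ x t, HasDerivAt (X x) (u (X x t)) t) (t : ℝ) :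
    ∃ C : ℝ, 0 ≤ C ∧ ∀ n : ℕ, 0 < n → ∀ x,
      ‖(fun z => z + (t / n) • u z)^[n] x - X x t‖ ≤ C / n := by
  have hM0 : 0 ≤ M := (norm_nonneg _).trans (hM 0)
  refine ⟨Ku * M * t ^ 2 * Real.exp (Ku * |t|), by positivity, fun n hn x => ?_⟩
  have h1 := aux_iter u Ku hu M hM X hX0 hXode x (t / n) n
  have hn' : (0:ℝ) < n := by exact_mod_cast hn
  rw [mul_div_cancel₀ _ hn'.ne'] at h1
  refine h1.trans ?_
  have h2 : (1 + Ku * |t / n|) ^ n ≤ Real.exp (Ku * |t|) := by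
    have : Ku * |t| = n * (Ku * |t / n|) := by
      rw [abs_div, abs_of_pos hn']; field_simp
    rw [this, Real.exp_nat_mul]
    gcongr
    rw [add_comm]; exact Real.add_one_le_exp _
  calc n * (Ku * M * (t / n) ^ 2) * (1 + Ku * |t / n|) ^ n
      ≤ n * (Ku * M * (t / n) ^ 2) * Real.exp (Ku * |t|) := by gcongr
    _ = _ := by field_simp

lemma aux_cont (u : ℝ × ℝ → ℝ × ℝ) (Ku : ℝ≥0) (hu : LipschitzWith Ku u)
    (M : ℝ) (hM : ∀ x, ‖u x‖ ≤ M)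
    (X : ℝ × ℝ → ℝ → ℝ × ℝ)
    (hX0 : ∀ x, X x 0 = x)
    (hXode : ∀ x t, HasDerivAt (X x) (u (X x t)) t) (t : ℝ) :
    Continuous (fun x => X x t) := by
  obtain ⟨C, hC0, hC⟩ := aux_conv u Ku hu M hM X hX0 hXode t
  have hlim : Tendsto (fun n : ℕ => C / (n:ℝ)) atTop (𝓝 0) :=
    tendsto_const_div_atTop_nhds_zero_nat C
  have hU : TendstoUniformly (fun (n : ℕ) x => (fun z => z + (t / n) • u z)^[n] x)
      (fun x => X x t) atTop := by
    rw [Metric.tendstoUniformly_iff]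
    intro ε hε
    filter_upwards [hlim.eventually (gt_mem_nhds hε), eventually_gt_atTop 0] with n hn hn0 x
    rw [dist_comm, dist_eq_norm]
    exact (hC n hn0 x).trans_lt hn
  refine hU.continuous (Eventually.of_forall fun n => ?_).frequently
  have := hu.continuous
  exact Continuous.iterate (by fun_prop) n

lemma aux_det (L : ℝ × ℝ →L[ℝ] ℝ × ℝ) (K h : ℝ) (hK : ‖L‖ ≤ K)
    (htr : (L (1, 0)).1 + (L (0, 1)).2 = 0) :
    1 - 2 * K ^ 2 * h ^ 2 ≤ |(ContinuousLinearMap.id ℝ (ℝ × ℝ) + h • L).det| := by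
  have hdet : (ContinuousLinearMap.id ℝ (ℝ × ℝ) + h • L).det =
      1 + h * ((L (1, 0)).1 + (L (0, 1)).2) +
      h ^ 2 * ((L (1, 0)).1 * (L (0, 1)).2 - (L (0, 1)).1 * (L (1, 0)).2) := by
    rw [ContinuousLinearMap.det, ← LinearMap.det_toMatrix (Module.Basis.finTwoProd ℝ),
      Matrix.det_fin_two]
    simp [LinearMap.toMatrix_apply]
    ring
  have hK0 : 0 ≤ K := (norm_nonneg _).trans hK
  have n1 : ‖L (1, 0)‖ ≤ K := by
    refine (L.le_opNorm _).trans ?_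
    simpa [Prod.norm_def] using hK
  have n2 : ‖L (0, 1)‖ ≤ K := by
    refine (L.le_opNorm _).trans ?_
    simpa [Prod.norm_def] using hK
  have a1 := abs_le.1 ((norm_fst_le _).trans n1)
  have a2 := abs_le.1 ((norm_snd_le _).trans n1)
  have b1 := abs_le.1 ((norm_fst_le _).trans n2)
  have b2 := abs_le.1 ((norm_snd_le _).trans n2)
  rw [hdet, htr]
  refine le_trans ?_ (le_abs_self _)
  have p1 : |(L (1, 0)).1 * (L (0, 1)).2| ≤ K * K := by
    rw [abs_mul]
    exact mul_le_mul (abs_le.2 a1) (abs_le.2 b2) (abs_nonneg _) hK0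
  have p2 : |(L (0, 1)).1 * (L (1, 0)).2| ≤ K * K := by
    rw [abs_mul]
    exact mul_le_mul (abs_le.2 b1) (abs_le.2 a2) (abs_nonneg _) hK0
  have := abs_le.1 p1
  have := abs_le.1 p2
  nlinarith [sq_nonneg h]

lemma aux_euler_meas (u : ℝ × ℝ → ℝ × ℝ) (Ku : ℝ≥0) (hu : LipschitzWith Ku u)
    (hdiv : ∀ᵐ x : ℝ × ℝ, (fderiv ℝ u x (1, 0)).1 + (fderiv ℝ u x (0, 1)).2 = 0)
    (h : ℝ) (hh : Ku * |h| < 1) (A : Set (ℝ × ℝ)) (hA : MeasurableSet A) :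
    ENNReal.ofReal (1 - 2 * Ku ^ 2 * h ^ 2) * volume A
      ≤ volume ((fun z => z + h • u z) '' A) := by
  set G : Set (ℝ × ℝ) := {x | (fderiv ℝ u x (1, 0)).1 + (fderiv ℝ u x (0, 1)).2 = 0 ∧
    DifferentiableAt ℝ u x}
  have hG : ∀ᵐ x : ℝ × ℝ, x ∈ G := by
    filter_upwards [hdiv, hu.ae_differentiableAt] with x h1 h2
    exact ⟨h1, h2⟩
  have hGae : G =ᵐ[volume] Set.univ := by
    filter_upwards [hG] with x hx
    exact propext ⟨fun _ => trivial, fun _ => hx⟩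
  have hAG : (A ∩ G : Set (ℝ × ℝ)) =ᵐ[volume] A := by
    simpa using (Filter.EventuallyEq.refl (ae volume) A).inter hGae
  have hnm : NullMeasurableSet (A ∩ G) volume := hA.nullMeasurableSet.congr hAG.symm
  have hinj : Set.InjOn (fun z => z + h • u z) (A ∩ G) := by
    intro x _ y _ hxy
    by_contra hne
    have hpos : 0 < ‖x - y‖ := norm_pos_iff.2 (sub_ne_zero.2 hne)
    have e : x - y = - (h • (u x - u y)) := by
      simp only at hxy
      rw [smul_sub, neg_sub, sub_eq_sub_iff_add_eq_add, hxy]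
      abel
    have h2 : ‖u x - u y‖ ≤ Ku * ‖x - y‖ := by
      simpa [dist_eq_norm] using hu.dist_le_mul x y
    have : ‖x - y‖ ≤ |h| * (Ku * ‖x - y‖) := by
      calc ‖x - y‖ = |h| * ‖u x - u y‖ := by rw [e, norm_neg, norm_smul, Real.norm_eq_abs]
        _ ≤ _ := by gcongr
    nlinarith
  have key := lintegral_abs_det_fderiv_eq_addHaar_image₀ (volume : Measure (ℝ × ℝ)) hnm
    (f := fun z => z + h • u z)
    (f' := fun x => ContinuousLinearMap.id ℝ (ℝ × ℝ) + h • fderiv ℝ u x)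
    (fun x hx => ((hasFDerivAt_id x).add (hx.2.2.hasFDerivAt.const_smul h)).hasFDerivWithinAt)
    hinj
  calc ENNReal.ofReal (1 - 2 * Ku ^ 2 * h ^ 2) * volume A
      = ENNReal.ofReal (1 - 2 * Ku ^ 2 * h ^ 2) * volume (A ∩ G) := by rw [measure_congr hAG]
    _ = ∫⁻ x in A ∩ G, ENNReal.ofReal (1 - 2 * Ku ^ 2 * h ^ 2) := by simp
    _ ≤ ∫⁻ x in A ∩ G, ENNReal.ofReal
          |(ContinuousLinearMap.id ℝ (ℝ × ℝ) + h • fderiv ℝ u x).det| := by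
        refine lintegral_mono_ae ?_
        refine (ae_restrict_of_ae hG).mono fun x hx => ENNReal.ofReal_le_ofReal ?_
        exact aux_det _ _ _ (norm_fderiv_le_of_lipschitz ℝ hu) hx.1
    _ = _ := key
    _ ≤ _ := measure_mono (Set.image_mono Set.inter_subset_left)

lemma aux_compact_le (u : ℝ × ℝ → ℝ × ℝ) (Ku : ℝ≥0) (hu : LipschitzWith Ku u)
    (hdiv : ∀ᵐ x : ℝ × ℝ, (fderiv ℝ u x (1, 0)).1 + (fderiv ℝ u x (0, 1)).2 = 0)
    (M : ℝ) (hM : ∀ x, ‖u x‖ ≤ M)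
    (X : ℝ × ℝ → ℝ → ℝ × ℝ)
    (hX0 : ∀ x, X x 0 = x)
    (hXode : ∀ x t, HasDerivAt (X x) (u (X x t)) t) (t : ℝ)
    (A : Set (ℝ × ℝ)) (hA : IsCompact A) :
    volume A ≤ volume ((fun x => X x t) '' A) := by
  obtain ⟨C, hC0, hC⟩ := aux_conv u Ku hu M hM X hX0 hXode t
  have hXA : IsCompact ((fun x => X x t) '' A) :=
    hA.image (aux_cont u Ku hu M hM X hX0 hXode t)
  have huc := hu.continuous
  have hlim : Tendsto (fun n : ℕ => C / (n:ℝ)) atTop (𝓝 0) :=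
    tendsto_const_div_atTop_nhds_zero_nat C
  have hR := (tendsto_measure_cthickening_of_isCompact (μ := volume) hXA).comp hlim
  have hL : Tendsto (fun n : ℕ => ENNReal.ofReal (1 - 2 * Ku ^ 2 * t ^ 2 / n) * volume A) atTop
      (𝓝 (ENNReal.ofReal 1 * volume A)) := by
    refine ENNReal.Tendsto.mul_const (ENNReal.tendsto_ofReal ?_) (Or.inl (by simp))
    have := (tendsto_const_div_atTop_nhds_zero_nat (2 * Ku ^ 2 * t ^ 2 : ℝ)).const_sub 1
    simpa using this
  rw [ENNReal.ofReal_one, one_mul] at hL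
  refine le_of_tendsto_of_tendsto hL hR ?_
  have hs1 : ∀ᶠ n : ℕ in atTop, Ku * |t| / (n:ℝ) < 1 :=
    (tendsto_const_div_atTop_nhds_zero_nat (Ku * |t|)).eventually (gt_mem_nhds one_pos)
  have hs2 : ∀ᶠ n : ℕ in atTop, 2 * Ku ^ 2 * t ^ 2 / (n:ℝ) < 1 :=
    (tendsto_const_div_atTop_nhds_zero_nat (2 * Ku ^ 2 * t ^ 2 : ℝ)).eventually
      (gt_mem_nhds one_pos)
  filter_upwards [hs1, hs2, eventually_gt_atTop 0] with n h1 h2 hn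
  have hn' : (1:ℝ) ≤ n := by exact_mod_cast hn
  have hn0 : (0:ℝ) < n := by linarith
  have hit : ∀ k : ℕ, ENNReal.ofReal (1 - 2 * Ku ^ 2 * (t / n) ^ 2) ^ k * volume A
      ≤ volume ((fun z => z + (t / n) • u z)^[k] '' A) := by
    intro k
    induction k with
    | zero => simp
    | succ k ih =>
      have hcc : IsCompact ((fun z => z + (t / n) • u z)^[k] '' A) :=
        hA.image (Continuous.iterate (by fun_prop) k)
      have := aux_euler_meas u Ku hu hdiv (t / n) (by
        rw [abs_div, abs_of_pos hn0, ← mul_div_assoc]; exact h1) _ hcc.isClosed.measurableSet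
      rw [Function.iterate_succ', Set.image_comp]
      refine le_trans ?_ this
      rw [pow_succ', mul_assoc]
      gcongr
  have hle2 : 2 * Ku ^ 2 * (t / n) ^ 2 ≤ 1 := by
    have : 2 * Ku ^ 2 * (t / n) ^ 2 = 2 * Ku ^ 2 * t ^ 2 / (n:ℝ) / n := by field_simp
    rw [this, div_le_one hn0]
    linarith
  calc ENNReal.ofReal (1 - 2 * Ku ^ 2 * t ^ 2 / n) * volume A
      ≤ ENNReal.ofReal (1 - 2 * Ku ^ 2 * (t / n) ^ 2) ^ n * volume A := by
        gcongr
        rw [← ENNReal.ofReal_pow (by linarith)]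
        refine ENNReal.ofReal_le_ofReal ?_
        have := one_add_mul_le_pow (a := -(2 * Ku ^ 2 * (t / n) ^ 2 : ℝ)) (by linarith) n
        rw [← sub_eq_add_neg] at this
        refine le_trans (le_of_eq ?_) this
        field_simp
        ring
    _ ≤ _ := hit n
    _ ≤ _ := by
      refine measure_mono ?_
      rintro _ ⟨x, hx, rfl⟩
      refine Metric.mem_cthickening_of_dist_le _ (X x t) _ _ ⟨x, hx, rfl⟩ ?_
      rw [dist_eq_norm]
      exact hC n hn x

lemma aux_mp (u : ℝ × ℝ → ℝ × ℝ) (Ku : ℝ≥0) (hu : LipschitzWith Ku u)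
    (hdiv : ∀ᵐ x : ℝ × ℝ, (fderiv ℝ u x (1, 0)).1 + (fderiv ℝ u x (0, 1)).2 = 0)
    (M : ℝ) (hM : ∀ x, ‖u x‖ ≤ M)
    (X : ℝ × ℝ → ℝ → ℝ × ℝ)
    (hX0 : ∀ x, X x 0 = x)
    (hXode : ∀ x t, HasDerivAt (X x) (u (X x t)) t) (t : ℝ) :
    MeasurePreserving (fun x => X x t) volume volume := by
  have hcont := aux_cont u Ku hu M hM X hX0 hXode
  have hinv : ∀ t x, X (X x t) (-t) = x := by
    intro t x
    rw [← aux_flow u Ku hu X hX0 hXode]; simp [hX0]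
  have hle : ∀ t, ∀ A, MeasurableSet A → volume A ≤ volume ((fun x => X x t) ⁻¹' A) := by
    intro t A hA
    rw [hA.measure_eq_iSup_isCompact]
    refine iSup₂_le fun K hKA => iSup_le fun hK => ?_
    refine (aux_compact_le u Ku hu hdiv M hM X hX0 hXode (-t) K hK).trans (measure_mono ?_)
    rintro _ ⟨x, hx, rfl⟩
    have := hinv (-t) x
    rw [neg_neg] at this
    simp only [Set.mem_preimage, this]
    exact hKA hx
  refine ⟨(hcont t).measurable, ?_⟩
  ext A hA
  rw [Measure.map_apply (hcont t).measurable hA]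
  refine le_antisymm ?_ (hle t A hA)
  refine (hle (-t) _ ((hcont t).measurable hA)).trans (measure_mono fun x hx => ?_)
  have := hinv (-t) x
  rw [neg_neg] at this
  simpa [this] using hx

lemma aux_rect (u : ℝ × ℝ → ℝ × ℝ) (Ku : ℝ≥0) (hu : LipschitzWith Ku u)
    (hdiv : ∀ᵐ x : ℝ × ℝ, (fderiv ℝ u x (1, 0)).1 + (fderiv ℝ u x (0, 1)).2 = 0)
    (a b c d : ℝ) :
    ∫ x in a..b, ((u (x, d)).2 - (u (x, c)).2) = - ∫ y in c..d, ((u (b, y)).1 - (u (a, y)).1) := by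
  set G : Set (ℝ × ℝ) := {x | (fderiv ℝ u x (1, 0)).1 + (fderiv ℝ u x (0, 1)).2 = 0 ∧
    DifferentiableAt ℝ u x}
  have hG : ∀ᵐ x : ℝ × ℝ, x ∈ G := by
    filter_upwards [hdiv, hu.ae_differentiableAt] with x h1 h2
    exact ⟨h1, h2⟩
  have m1 : Measurable (fun x => (fderiv ℝ u x (1, 0)).1) :=
    (measurable_fderiv_apply_const ℝ u _).fst
  have m2 : Measurable (fun x => (fderiv ℝ u x (0, 1)).2) :=
    (measurable_fderiv_apply_const ℝ u _).snd
  have hGm : MeasurableSet G :=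
    (measurableSet_eq_fun (m1.add m2) measurable_const).inter
      (measurableSet_of_differentiableAt ℝ u)
  have hxy : ∀ᵐ x : ℝ, ∀ᵐ y : ℝ, (x, y) ∈ G :=
    (Measure.ae_prod_iff_ae_ae (μ := volume) (ν := volume) hGm).1 hG
  have hyx : ∀ᵐ y : ℝ, ∀ᵐ x : ℝ, (x, y) ∈ G :=
    (Measure.ae_ae_comm (p := fun x y => (x, y) ∈ G) hGm).1 hxy
  have hp1 : ∀ p : ℝ × ℝ, p ∈ G → HasDerivAt (fun s => (u (s, p.2)).1) (fderiv ℝ u p (1, 0)).1 p.1 := by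
    intro p hp
    have h1 : HasDerivAt (fun s : ℝ => (s, p.2)) ((1:ℝ), (0:ℝ)) p.1 :=
      (hasDerivAt_id _).prodMk (hasDerivAt_const _ _)
    have h2 := (hp.2.hasFDerivAt (x := (p.1, p.2))).comp_hasDerivAt p.1 h1
    exact (hasFDerivAt_fst (𝕜 := ℝ)).comp_hasDerivAt p.1 h2
  have hp2 : ∀ p : ℝ × ℝ, p ∈ G → HasDerivAt (fun s => (u (p.1, s)).2) (fderiv ℝ u p (0, 1)).2 p.2 := by
    intro p hp
    have h1 : HasDerivAt (fun s : ℝ => (p.1, s)) ((0:ℝ), (1:ℝ)) p.2 :=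
      (hasDerivAt_const _ _).prodMk (hasDerivAt_id _)
    have h2 := (hp.2.hasFDerivAt (x := (p.1, p.2))).comp_hasDerivAt p.2 h1
    exact (hasFDerivAt_snd (𝕜 := ℝ)).comp_hasDerivAt p.2 h2
  have l1 : ∀ y, LipschitzWith Ku (fun s => (u (s, y)).1) := fun y => by
    have := (LipschitzWith.prod_fst.comp hu).comp (LipschitzWith.prodMk_right y)
    rw [one_mul, mul_one] at this
    exact this
  have l2 : ∀ x, LipschitzWith Ku (fun s => (u (x, s)).2) := fun x => by
    have := (LipschitzWith.prod_snd.comp hu).comp (LipschitzWith.prodMk_left x)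
    rw [one_mul, mul_one] at this
    exact this
  have i1 : ∀ᵐ y : ℝ, ∫ x in a..b, (fderiv ℝ u (x, y) (1, 0)).1 = (u (b, y)).1 - (u (a, y)).1 := by
    filter_upwards [hyx] with y hy
    rw [← (l1 y).lipschitzOnWith.absolutelyContinuousOnInterval.integral_deriv_eq_sub]
    refine intervalIntegral.integral_congr_ae ?_
    filter_upwards [hy] with x hx _
    exact (hp1 (x, y) hx).deriv.symm
  have i2 : ∀ᵐ x : ℝ, ∫ y in c..d, -(fderiv ℝ u (x, y) (1, 0)).1 = (u (x, d)).2 - (u (x, c)).2 := by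
    filter_upwards [hxy] with x hx
    rw [← (l2 x).lipschitzOnWith.absolutelyContinuousOnInterval.integral_deriv_eq_sub]
    refine intervalIntegral.integral_congr_ae ?_
    filter_upwards [hx] with y hy _
    have := (hp2 (x, y) hy).deriv
    simp only at this
    rw [this]
    linarith [hy.1]
  rw [← intervalIntegral.integral_congr_ae (i1.mono fun y h _ => h),
    ← intervalIntegral.integral_congr_ae (i2.mono fun y h _ => h)]
  simp only [intervalIntegral.integral_neg]
  congr 1
  refine intervalIntegral_intervalIntegral_swap (F := fun x y => (fderiv ℝ u (x, y) (1, 0)).1) ?_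
  have hfin : volume (Set.uIoc a b ×ˢ Set.uIoc c d) < ⊤ := by
    rw [Measure.volume_eq_prod, Measure.prod_prod]
    simp [Set.uIoc, ENNReal.mul_lt_top]
  refine Measure.integrableOn_of_bounded (M := Ku) hfin.ne m1.aestronglyMeasurable
    (Eventually.of_forall fun x => ?_)
  refine (norm_fst_le _).trans ((ContinuousLinearMap.le_opNorm _ _).trans ?_)
  have := norm_fderiv_le_of_lipschitz ℝ hu (x₀ := x)
  simpa [Prod.norm_def] using this

lemma aux_stream (u : ℝ × ℝ → ℝ × ℝ) (Ku : ℝ≥0) (hu : LipschitzWith Ku u)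
    (hdiv : ∀ᵐ x : ℝ × ℝ, (fderiv ℝ u x (1, 0)).1 + (fderiv ℝ u x (0, 1)).2 = 0) :
    ∃ (U : ℝ × ℝ → ℝ) (U' : ℝ × ℝ → (ℝ × ℝ →L[ℝ] ℝ)), (∀ x, HasFDerivAt U (U' x) x) ∧
      ∀ x v, U' x v = -(u x).2 * v.1 + (u x).1 * v.2 := by
  have huc := hu.continuous
  let f : ℝ → ℝ → ℝ := fun x y => (∫ t in (0:ℝ)..y, (u (0, t)).1) - ∫ s in (0:ℝ)..x, (u (s, y)).2
  have hf : ∀ x y, f x y = (∫ t in (0:ℝ)..y, (u (x, t)).1) - ∫ s in (0:ℝ)..x, (u (s, 0)).2 := by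
    intro x y
    have h := aux_rect u Ku hu hdiv 0 x 0 y
    rw [intervalIntegral.integral_sub, intervalIntegral.integral_sub] at h
    · simp only [f]; linarith
    all_goals exact Continuous.intervalIntegrable (by fun_prop) _ _
  let f₁ : ℝ → ℝ → ℝ →L[ℝ] ℝ := fun x y => ContinuousLinearMap.toSpanSingleton ℝ (-(u (x, y)).2)
  let f₂ : ℝ → ℝ → ℝ →L[ℝ] ℝ := fun x y => ContinuousLinearMap.toSpanSingleton ℝ ((u (x, y)).1)
  refine ⟨fun p => f p.1 p.2, fun p => (f₁ p.1 p.2).coprod (f₂ p.1 p.2), fun p => ?_, ?_⟩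
  · have := hasStrictFDerivAt_uncurry_coprod (𝕜 := ℝ) (u := p) (f := f) (f₁ := f₁) (f₂ := f₂)
      (Eventually.of_forall fun v => by
        have h : Continuous fun s => (u (s, v.2)).2 := by fun_prop
        have := (h.integral_hasStrictDerivAt 0 v.1).hasDerivAt.const_sub
          (∫ t in (0:ℝ)..v.2, (u (0, t)).1)
        exact this.hasFDerivAt)
      (Eventually.of_forall fun v => by
        have h : Continuous fun s => (u (v.1, s)).1 := by fun_prop
        have := (h.integral_hasStrictDerivAt 0 v.2).hasDerivAt.sub_const
          (∫ s in (0:ℝ)..v.1, (u (s, 0)).2)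
        have h2 := this.hasFDerivAt
        have e : (f v.1 ·) = fun y => (∫ t in (0:ℝ)..y, (u (v.1, t)).1)
          - ∫ s in (0:ℝ)..v.1, (u (s, 0)).2 := funext fun y => hf _ _
        rw [e]
        exact h2)
      (by
        refine Continuous.continuousAt ?_
        change Continuous fun p : ℝ × ℝ => f₁ p.1 p.2
        have hc : Continuous fun p : ℝ × ℝ => -(u (p.1, p.2)).2 := by fun_prop
        exact (ContinuousLinearMap.toSpanSingletonCLE (𝕜 := ℝ) (E := ℝ)).continuous.comp hc)
      (by
        refine Continuous.continuousAt ?_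
        change Continuous fun p : ℝ × ℝ => f₂ p.1 p.2
        have hc : Continuous fun p : ℝ × ℝ => (u (p.1, p.2)).1 := by fun_prop
        exact (ContinuousLinearMap.toSpanSingletonCLE (𝕜 := ℝ) (E := ℝ)).continuous.comp hc)
    exact this.hasFDerivAt
  · intro x v
    simp [f₁, f₂]
    ring

lemma aux_local (u : ℝ × ℝ → ℝ × ℝ) (huc : Continuous u)
    (M : ℝ) (hM : ∀ x, ‖u x‖ ≤ M)
    (X : ℝ × ℝ → ℝ → ℝ × ℝ)
    (hX0 : ∀ x, X x 0 = x)
    (hXode : ∀ x t, HasDerivAt (X x) (u (X x t)) t)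
    (U : ℝ × ℝ → ℝ) (U' : ℝ × ℝ → (ℝ × ℝ →L[ℝ] ℝ)) (hU : ∀ x, HasFDerivAt U (U' x) x)
    (hU' : ∀ x v, U' x v = -(u x).2 * v.1 + (u x).1 * v.2)
    (hUX : ∀ x t, U (X x t) = U x)
    (p : ℝ × ℝ) (hp : u p ≠ 0) :
    ∃ δ > 0, ∀ z ∈ Metric.ball p δ, u z ≠ 0 ∧ ∀ w ∈ Metric.ball p δ, U z = U w →
      ∃ s, |s| ≤ 1 / 2 ∧ X z s = w := by
  have hM0 : 0 ≤ M := (norm_nonneg _).trans (hM 0)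
  obtain ⟨a, ha⟩ : ∃ a, a = u p := ⟨_, rfl⟩
  let q : ℝ × ℝ → ℝ := fun v => a.1 * v.1 + a.2 * v.2
  have hqc : Continuous q := by fun_prop
  have hN : 0 < q a := by
    have : a.1 ≠ 0 ∨ a.2 ≠ 0 := by
      by_contra! h
      exact hp (ha ▸ Prod.ext h.1 h.2)
    rcases this with h | h
    · have := mul_self_pos.2 h; have := mul_self_nonneg a.2; simp only [q]; linarith
    · have := mul_self_pos.2 h; have := mul_self_nonneg a.1; simp only [q]; linarith
  obtain ⟨N, hNdef⟩ : ∃ N, N = q a := ⟨_, rfl⟩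
  rw [← hNdef] at hN
  obtain ⟨r, hr, hrq⟩ : ∃ r > 0, ∀ x ∈ Metric.ball p r, N / 2 < q (u x) := by
    have : ∀ᶠ x in 𝓝 p, N / 2 < q (u x) := by
      refine (hqc.comp huc).continuousAt.eventually (lt_mem_nhds ?_)
      simp only [Function.comp, ← ha, ← hNdef]; linarith
    exact Metric.eventually_nhds_iff_ball.1 this
  obtain ⟨s0, hs0, hs0h, hs0r⟩ : ∃ s0 > 0, s0 ≤ 1 / 2 ∧ M * s0 < r / 2 := by
    refine ⟨min (1/2) (r / (2 * (M + 1))), by positivity, min_le_left _ _, ?_⟩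
    have h1 : M * min (1/2) (r / (2 * (M + 1))) ≤ M * (r / (2 * (M + 1))) := by
      gcongr; exact min_le_right _ _
    refine h1.trans_lt ?_
    rw [← mul_div_assoc, div_lt_div_iff₀ (by positivity) (by positivity)]
    nlinarith
  obtain ⟨δ', hδ', hδq⟩ : ∃ δ > 0, ∀ x ∈ Metric.ball p δ, |q x - q p| < s0 * N / 4 := by
    have : ∀ᶠ x in 𝓝 p, |q x - q p| < s0 * N / 4 := by
      have := (Metric.tendsto_nhds.1 (hqc.continuousAt (x := p))) (s0 * N / 4) (by positivity)
      simpa [Real.dist_eq] using this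
    exact Metric.eventually_nhds_iff_ball.1 this
  refine ⟨min δ' (r / 2), by positivity, fun z hz => ⟨?_, fun w hw hzw => ?_⟩⟩
  · intro h0
    have hzr : z ∈ Metric.ball p r :=
      Metric.ball_subset_ball ((min_le_right _ _).trans (by linarith)) hz
    have := hrq z hzr
    rw [h0] at this
    simp [q] at this
    linarith
  have hzr := Metric.ball_subset_ball (min_le_right _ _) hz
  have hwr : w ∈ Metric.ball p r :=
    Metric.ball_subset_ball ((min_le_right _ _).trans (by linarith)) hw
  have hzq := abs_lt.1 (hδq z (Metric.ball_subset_ball (min_le_left _ _) hz))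
  have hwq := abs_lt.1 (hδq w (Metric.ball_subset_ball (min_le_left _ _) hw))
  have hin : ∀ s, |s| ≤ s0 → X z s ∈ Metric.ball p r := by
    intro s hs
    have h1 := aux_speed u M hM X hX0 hXode z s
    have h2 : M * |s| ≤ M * s0 := by gcongr
    rw [Metric.mem_ball] at hzr ⊢
    have h3 := dist_triangle (X z s) z p
    rw [dist_eq_norm (X z s) z] at h3
    linarith
  have hg : ∀ s, HasDerivAt (fun s => q (X z s)) (q (u (X z s))) s := by
    intro s
    have h1 := hXode z s
    have h2 := (hasFDerivAt_fst (𝕜 := ℝ)).comp_hasDerivAt s h1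
    have h3 := (hasFDerivAt_snd (𝕜 := ℝ)).comp_hasDerivAt s h1
    exact (h2.const_mul a.1).add (h3.const_mul a.2)
  have hgc : Continuous (fun s => q (X z s)) :=
    continuous_iff_continuousAt.2 fun s => (hg s).continuousAt
  have hup : q z + s0 * N / 2 ≤ q (X z s0) := by
    obtain ⟨ξ, hξ, he⟩ := exists_hasDerivAt_eq_slope (fun s => q (X z s)) _ hs0 hgc.continuousOn
      (fun s _ => hg s)
    have h1 := hrq _ (hin ξ (by rw [abs_of_pos hξ.1]; exact hξ.2.le))
    rw [he, hX0, lt_div_iff₀ (by linarith)] at h1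
    linarith
  have hdn : q (X z (-s0)) ≤ q z - s0 * N / 2 := by
    obtain ⟨ξ, hξ, he⟩ := exists_hasDerivAt_eq_slope (fun s => q (X z s)) _ (neg_lt_zero.2 hs0)
      hgc.continuousOn (fun s _ => hg s)
    have h1 := hrq _ (hin ξ (by rw [abs_of_neg hξ.2]; linarith [hξ.1]))
    rw [he, hX0, lt_div_iff₀ (by linarith)] at h1
    linarith
  obtain ⟨s, hs, hsq⟩ : ∃ s ∈ Set.Icc (-s0) s0, q (X z s) = q w :=
    intermediate_value_Icc (by linarith) hgc.continuousOn ⟨by linarith, by linarith⟩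
  have hsabs : |s| ≤ s0 := abs_le.2 hs
  refine ⟨s, hsabs.trans hs0h, ?_⟩
  obtain ⟨v, hv⟩ : ∃ v, v = X z s - w := ⟨_, rfl⟩
  have hav : a.1 * v.1 + a.2 * v.2 = 0 := by
    simp only [q] at hsq
    rw [hv]; simp only [Prod.fst_sub, Prod.snd_sub]; linarith
  have hφ : ∀ τ : ℝ, HasDerivAt (fun τ : ℝ => U (w + τ • v)) (U' (w + τ • v) v) τ := by
    intro τ
    have h1 : HasDerivAt (fun τ : ℝ => w + τ • v) ((1:ℝ) • v) τ :=
      ((hasDerivAt_id τ).smul_const v).const_add w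
    rw [one_smul] at h1
    exact (hU _).comp_hasDerivAt τ h1
  obtain ⟨τ, hτ, h0⟩ := exists_hasDerivAt_eq_zero (f := fun τ : ℝ => U (w + τ • v)) one_pos
    (fun τ _ => (hφ τ).continuousAt.continuousWithinAt)
    (by simp [hv, hUX, hzw]) (fun τ _ => hφ τ)
  have hy : w + τ • v ∈ Metric.ball p r := by
    rw [hv]
    exact (convex_ball p r).add_smul_sub_mem hwr (hin s hsabs) ⟨hτ.1.le, hτ.2.le⟩
  have hq := hrq _ hy
  rw [hU'] at h0
  set b := u (w + τ • v)
  have hid : (a.1 * b.1 + a.2 * b.2) * (v.1 * v.1 + v.2 * v.2) = 0 := by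
    linear_combination (b.1 * v.1 + b.2 * v.2) * hav + (a.1 * v.2 - a.2 * v.1) * h0
  have hqb : a.1 * b.1 + a.2 * b.2 ≠ 0 := by
    simp only [q] at hq; linarith
  have hvv := (mul_eq_zero.1 hid).resolve_left hqb
  have hv0 : v = 0 := by
    have h1 := mul_self_nonneg v.1
    have h2 := mul_self_nonneg v.2
    exact Prod.ext (mul_self_eq_zero.1 (by linarith)) (mul_self_eq_zero.1 (by linarith))
  rw [hv] at hv0
  exact sub_eq_zero.1 hv0

/-- From the proof of Lemma 4.0: if every streamline of the 1-periodic incompressible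
Lipschitz flow `u` on `ℝ²` meeting a nonempty open bounded set `Y` is bounded, and `u` does
not vanish identically on any nonempty open subset of `Y`, then `u` has a non-trivial closed
streamline: `X(y,τ) = y` for some `τ > 0` and `u(y) ≠ 0`. -/
theorem stmt_10
    (u : ℝ × ℝ → ℝ × ℝ) (Ku : ℝ≥0) (hu : LipschitzWith Ku u)
    (huper1 : ∀ x : ℝ × ℝ, u (x + (1, 0)) = u x)
    (huper2 : ∀ x : ℝ × ℝ, u (x + (0, 1)) = u x)
    (hdiv : ∀ᵐ x : ℝ × ℝ, (fderiv ℝ u x (1, 0)).1 + (fderiv ℝ u x (0, 1)).2 = 0)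
    (X : ℝ × ℝ → ℝ → ℝ × ℝ)
    (hX0 : ∀ x, X x 0 = x)
    (hXode : ∀ x t, HasDerivAt (X x) (u (X x t)) t)
    (Y : Set (ℝ × ℝ)) (hYopen : IsOpen Y) (hYbd : Bornology.IsBounded Y)
    (hYne : Y.Nonempty)
    (hbdd : ∀ x : ℝ × ℝ, (∃ t : ℝ, X x t ∈ Y) → Bornology.IsBounded (Set.range (X x)))
    (hnot0 : ∀ W : Set (ℝ × ℝ), W ⊆ Y → IsOpen W → W.Nonempty → ∃ x ∈ W, u x ≠ 0) :
    ∃ (y : ℝ × ℝ) (τ : ℝ), 0 < τ ∧ X y τ = y ∧ u y ≠ 0 := by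
  obtain ⟨M, hM0, hM⟩ := aux_bdd u hu.continuous huper1 huper2
  obtain ⟨U, U', hU, hU'⟩ := aux_stream u Ku hu hdiv
  have hUX : ∀ x t, U (X x t) = U x := by
    intro x t
    have hd : ∀ s, HasDerivAt (fun s => U (X x s)) 0 s := by
      intro s
      have := (hU (X x s)).comp_hasDerivAt s (hXode x s)
      have e : U' (X x s) (u (X x s)) = 0 := by rw [hU']; ring
      rw [e] at this
      exact this
    have := is_const_of_deriv_eq_zero (fun s => (hd s).differentiableAt)
      (fun s => (hd s).deriv) t 0
    simpa [hX0] using this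
  obtain ⟨p, hpY, hp⟩ := hnot0 Y subset_rfl hYopen hYne
  obtain ⟨δ, hδ, hloc⟩ := aux_local u hu.continuous M hM X hX0 hXode U U' hU hU' hUX p hp
  let V : Set (ℝ × ℝ) := Y ∩ Metric.ball p δ
  have hVo : IsOpen V := hYopen.inter Metric.isOpen_ball
  have hVpos : 0 < volume V := hVo.measure_pos volume ⟨p, hpY, Metric.mem_ball_self hδ⟩
  let B : ℕ → Set (ℝ × ℝ) := fun n => {x | ∀ t, ‖X x t‖ ≤ n}
  have hcont := aux_cont u Ku hu M hM X hX0 hXode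
  have hflow := aux_flow u Ku hu X hX0 hXode
  have hBc : ∀ n, IsClosed (B n) := by
    intro n
    have : B n = ⋂ t, {x | ‖X x t‖ ≤ n} := by ext x; simp [B]
    rw [this]
    exact isClosed_iInter fun t => isClosed_le (hcont t).norm continuous_const
  have hcov : V ⊆ ⋃ n, V ∩ B n := by
    intro x hx
    obtain ⟨R, hR⟩ := (hbdd x ⟨0, by rw [hX0]; exact hx.1⟩).exists_norm_le
    obtain ⟨n, hn⟩ := exists_nat_ge R
    exact Set.mem_iUnion.2 ⟨n, hx, fun t => (hR _ ⟨t, rfl⟩).trans hn⟩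
  obtain ⟨n, hn⟩ : ∃ n, volume (V ∩ B n) ≠ 0 := by
    by_contra! h
    exact hVpos.ne' (measure_mono_null hcov (measure_iUnion_null h))
  have hBfin : volume (B n) ≠ ⊤ := by
    have : B n ⊆ Metric.closedBall 0 n := by
      intro x hx
      have := hx 0
      rw [hX0] at this
      simpa using this
    exact (measure_mono this).trans_lt measure_closedBall_lt_top |>.ne
  have hmp := (aux_mp u Ku hu hdiv M hM X hX0 hXode 1).restrict_preimage (hBc n).measurableSet
  have hpre : (fun x => X x 1) ⁻¹' (B n) = B n := by
    ext x
    constructor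
    · intro h t
      have := h (t - 1)
      rw [← hflow] at this
      simpa using this
    · intro h t
      have := h (1 + t)
      rwa [hflow] at this
  rw [hpre] at hmp
  have : IsFiniteMeasure (volume.restrict (B n)) := ⟨by simpa using hBfin.lt_top⟩
  obtain ⟨z, hz, m, hm, hzm⟩ := hmp.exists_mem_iterate_mem (s := V ∩ B n)
    (hVo.measurableSet.inter (hBc n).measurableSet).nullMeasurableSet
    (by rwa [Measure.restrict_apply (hVo.measurableSet.inter (hBc n).measurableSet),
      Set.inter_assoc, Set.inter_self])
  have hit : ∀ k : ℕ, (fun x => X x 1)^[k] z = X z k := by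
    intro k
    induction k with
    | zero => simp [hX0]
    | succ k ih => rw [Function.iterate_succ_apply', ih, Nat.cast_succ, hflow]
  rw [hit] at hzm
  obtain ⟨hu0, hl⟩ := hloc z hz.1.2
  obtain ⟨s, hs, hXs⟩ := hl _ hzm.1.2 (hUX z m).symm
  have hm1 : (1:ℝ) ≤ m := by exact_mod_cast Nat.one_le_iff_ne_zero.2 hm
  refine ⟨z, m - s, by linarith [(abs_le.1 hs).2], ?_, hu0⟩
  rw [sub_eq_add_neg, hflow, ← hXs, ← hflow, add_neg_cancel, hX0]
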